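/- For every integer k ≥ 213, if q_n denotes the n-th prime and π(k) the number of primes at most k, then the set ℋ = {q_{π(k)+1}, q_{π(k)+2}, …, q_{π(k)+k}} is admissible and its diameter satisfies q_{π(k)+k} − q_{π(k)+1} ≤ 1.6·k·log(k). -/

import Mathlib

open Nat

namespace PT

/-- counts the coprime to `P` ones among the `l` numbers `s, s + 2, s + 4, …`
(binary splitting, with fuel) -/
def cnt (P : ℕ) (d : ℕ) : ℕ → ℕ → ℕ :=
  Nat.rec (fun _ _ => 0)
    (fun _ ih s l => cond (Nat.ble l 1)
      (Nat.mul l (cond (Nat.beq (Nat.gcd s P) 1) 1 0))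
      (Nat.add (ih s (Nat.div l 2))
        (ih (Nat.add s (Nat.mul 2 (Nat.div l 2))) (Nat.sub l (Nat.div l 2))))) d

/-- checks a table of values of the prime counting function -/
def chain (P : ℕ) : ℕ → ℕ → List (ℕ × ℕ) → Bool
  | _, _, [] => true
  | s, c, (n, v) :: t =>
    Nat.beq (s + 2 * ((n - s) / 2)) n && (Nat.ble ((n - s) / 2) (2 ^ 19) &&
      (Nat.beq (c + cnt P 20 s ((n - s) / 2)) v && chain P n v t))

/-- table for small arguments -/
def tab1 : List (ℕ × ℕ) :=
  [(255, 54), (307, 62), (371, 73), (451, 87), (541, 99)]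

/-- table for large arguments -/
def tab2 : List (ℕ × ℕ) :=
  [(549, 101), (673, 121), (829, 144), (1029, 172), (1279, 206),
   (1603, 252), (2009, 304), (2039, 308), (2515, 368), (2535, 370),
   (3115, 443), (3209, 453), (3879, 537), (4079, 561), (4859, 650),
   (5211, 693), (6081, 793), (6667, 859), (7681, 973), (8571, 1067),
   (9741, 1201), (11047, 1337), (12437, 1484), (14269, 1675), (15909, 1854),
   (16001, 1862), (20505, 2313), (26437, 2904), (34293, 3663), (44643, 4640),
   (58313, 5903), (76497, 7525), (100537, 9637), (132679, 12384), (175425, 15943),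
   (232527, 20639)]

/-- product of the primes up to 23 -/
def P1 : ℕ := 223092870

/-- product of the primes up to 523 -/
def P2 : ℕ := 8709668761379269784034173446876636639594408083936553641753483991897255703964943107588335040121154680170867105541177741204814011615930342030904704147856733048115934632145172739949220591246493529224396454328521288726490

/-- rows: a, b, count of primes below b, X, count of primes below X, l, where `l / 100 ≤ log a` -/
def rows : List (ℕ × ℕ × ℕ × ℕ × ℕ × ℕ) :=
  [(213, 255, 54, 2039, 308, 536), (255, 307, 62, 2515, 368, 554), (307, 371, 73, 3115, 443, 572), (371, 451, 87, 3879, 537, 591), (451, 549, 101, 4859, 650, 611),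
   (549, 673, 121, 6081, 793, 630), (673, 829, 144, 7681, 973, 651), (829, 1029, 172, 9741, 1201, 672), (1029, 1279, 206, 12437, 1484, 693), (1279, 1603, 252, 15909, 1854, 715),
   (1603, 2009, 304, 20505, 2313, 737), (2009, 2535, 370, 26437, 2904, 760), (2535, 3209, 453, 34293, 3663, 783), (3209, 4079, 561, 44643, 4640, 807), (4079, 5211, 693, 58313, 5903, 831),
   (5211, 6667, 859, 76497, 7525, 855), (6667, 8571, 1067, 100537, 9637, 880), (8571, 11047, 1337, 132679, 12384, 905), (11047, 14269, 1675, 175425, 15943, 930), (14269, 16001, 1862, 232527, 20639, 956)]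

theorem chain1_ok : chain P1 29 9 tab1 = true := by decide +kernel

theorem chain2_ok : chain P2 541 99 tab2 = true := by decide +kernel

theorem cnt_succ (P d s l : ℕ) : cnt P (d + 1) s l = cond (Nat.ble l 1)
      (l * (cond (Nat.beq (Nat.gcd s P) 1) 1 0))
      (cnt P d s (l / 2) + cnt P d (s + 2 * (l / 2)) (l - l / 2)) := rfl

theorem leaf (g : ℕ) : (cond (Nat.beq g 1) 1 0 : ℕ) = if g = 1 then 1 else 0 := by
  by_cases h : g = 1
  · subst h; rfl
  · have e2 : Nat.beq g 1 = false := by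
      rw [Bool.eq_false_iff]; intro hh; exact h (Nat.eq_of_beq_eq_true hh)
    rw [e2, cond_false, if_neg h]

theorem cnt_small (P d s l : ℕ) (hs : s % 2 = 1) (h3 : 3 ≤ s) (hl : l ≤ 1)
    (h : ∀ n, s ≤ n → n < s + 2 * l → (n.Prime ↔ Nat.gcd n P = 1)) :
    Nat.count Nat.Prime s + cnt P (d + 1) s l = Nat.count Nat.Prime (s + 2 * l) := by
  rw [cnt_succ, leaf, Nat.ble_eq_true_of_le hl, cond_true]
  have : l = 0 ∨ l = 1 := by omega
  rcases this with rfl | rfl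
  · simp
  · have h1 := h s le_rfl (by omega)
    have h2 : ¬ (s + 1).Prime := by
      intro hp
      rcases hp.eq_two_or_odd with h | h <;> omega
    rw [show s + 2 * 1 = s + 1 + 1 by ring, Nat.count_succ, Nat.count_succ, if_neg h2]
    simp only [h1, one_mul, add_zero]

theorem cnt_eq (P : ℕ) (d : ℕ) : ∀ s l, l ≤ 2 ^ d → s % 2 = 1 → 3 ≤ s →
    (∀ n, s ≤ n → n < s + 2 * l → (n.Prime ↔ Nat.gcd n P = 1)) →
    Nat.count Nat.Prime s + cnt P (d + 1) s l = Nat.count Nat.Prime (s + 2 * l) := by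
  induction d with
  | zero =>
    intro s l hl hs h3 h
    exact cnt_small P 0 s l hs h3 (by simpa using hl) h
  | succ d ih =>
    intro s l hl hs h3 h
    by_cases h1 : l ≤ 1
    · exact cnt_small P _ s l hs h3 h1 h
    · have e1 : Nat.ble l 1 = false := by
        rw [Bool.eq_false_iff]; intro hh; exact h1 (Nat.le_of_ble_eq_true hh)
      rw [cnt_succ, e1, cond_false, ← Nat.add_assoc]
      rw [pow_succ] at hl
      rw [ih s (l / 2) (by omega) hs h3 (fun n h2 h3 => h n h2 (by omega)),
        ih (s + 2 * (l / 2)) (l - l / 2) (by omega) (by omega) (by omega)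
          (fun n h2 h3 => h n (by omega) (by omega))]
      congr 1
      omega

theorem chain_ok (P B : ℕ) : ∀ (t : List (ℕ × ℕ)) (s c : ℕ), s % 2 = 1 → 3 ≤ s →
    (∀ n, s ≤ n → n < B → (n.Prime ↔ Nat.gcd n P = 1)) →
    Nat.count Nat.Prime s = c → (∀ e ∈ t, e.1 ≤ B) → chain P s c t = true →
    ∀ e ∈ t, Nat.count Nat.Prime e.1 = e.2 := by
  intro t
  induction t with
  | nil => intro s c _ _ _ _ _ _ e he; simp at he
  | cons x t ih =>
    obtain ⟨n, v⟩ := x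
    intro s c hs hs3 h hc hB hch
    simp only [chain, Bool.and_eq_true] at hch
    obtain ⟨h1, h2, h3, h4⟩ := hch
    have h1 := Nat.eq_of_beq_eq_true h1
    have h2 := Nat.le_of_ble_eq_true h2
    have h3 := Nat.eq_of_beq_eq_true h3
    have hn : n ≤ B := hB (n, v) (by simp)
    have key := cnt_eq P 19 s ((n - s) / 2) h2 hs hs3 (fun m a b => h m a (by omega))
    have hv : Nat.count Nat.Prime n = v := by
      rw [← h3, ← hc, key, h1]
    intro e he
    rcases List.mem_cons.1 he with rfl | he
    · exact hv
    · exact ih n v (by omega) (by omega) (fun m a b => h m (by omega) b) hv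
        (fun e he => hB e (List.mem_cons_of_mem _ he)) h4 e he

theorem valid (P m : ℕ) (hP : ∀ d < m, 2 ≤ d → Nat.gcd d P ≠ 1) (hm : P ∣ (m - 1)!) (hm0 : 1 < m) :
    ∀ n, m ≤ n → n < m ^ 2 → (n.Prime ↔ Nat.gcd n P = 1) := by
  intro n h1 h2
  constructor
  · intro hn
    rcases (Nat.coprime_or_dvd_of_prime hn P) with h | h
    · exact h
    · have := (hn.dvd_factorial).1 (h.trans hm)
      omega
  · intro hg
    by_contra hn
    have h3 := Nat.minFac_sq_le_self (by omega) hn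
    have h4 : n.minFac < m := lt_of_pow_lt_pow_left₀ 2 (by omega) (lt_of_le_of_lt h3 h2)
    apply hP _ h4 (Nat.minFac_prime (by omega)).two_le
    exact Nat.Coprime.coprime_dvd_left (Nat.minFac_dvd n) hg

theorem tab1_ok : ∀ e ∈ tab1, Nat.count Nat.Prime e.1 = e.2 := by
  refine chain_ok P1 (29 ^ 2) tab1 29 9 (by norm_num) (by norm_num) (valid P1 29 ?_ ?_ (by norm_num)) ?_ ?_ chain1_ok
  · decide +kernel
  · decide +kernel
  · decide +kernel
  · decide +kernel

theorem count541 : Nat.count Nat.Prime 541 = 99 := tab1_ok (541, 99) (by decide +kernel)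

theorem tab2_ok : ∀ e ∈ tab2, Nat.count Nat.Prime e.1 = e.2 := by
  refine chain_ok P2 (541 ^ 2) tab2 541 99 (by norm_num) (by norm_num)
    (valid P2 541 ?_ ?_ (by norm_num)) count541 ?_ chain2_ok
  · decide +kernel
  · decide +kernel
  · decide +kernel

theorem tab_ok : ∀ e ∈ tab1 ++ tab2, Nat.count Nat.Prime e.1 = e.2 := by
  intro e he
  rcases List.mem_append.1 he with h | h
  exacts [tab1_ok e h, tab2_ok e h]

/-- consecutive rows cover an interval -/
def covers : ℕ → List (ℕ × ℕ × ℕ × ℕ × ℕ × ℕ) → Bool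
  | s, [] => Nat.beq s 16001
  | s, (a, b, _) :: t => Nat.beq s a && covers b t

theorem covers_ok (k : ℕ) (hk' : k < 16001) : ∀ (t : List (ℕ × ℕ × ℕ × ℕ × ℕ × ℕ)) (s : ℕ), s ≤ k →
    covers s t = true → ∃ r ∈ t, r.1 ≤ k ∧ k < r.2.1 := by
  intro t
  induction t with
  | nil => intro s hs h; have := Nat.eq_of_beq_eq_true h; omega
  | cons x t ih =>
    obtain ⟨a, b, y⟩ := x
    intro s hs h
    simp only [covers, Bool.and_eq_true] at h
    have h1 := Nat.eq_of_beq_eq_true h.1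
    by_cases hb : k < b
    · exact ⟨(a, b, y), by simp, by simp; omega, hb⟩
    · obtain ⟨r, hr, h2⟩ := ih b (by omega) h.2
      exact ⟨r, List.mem_cons_of_mem _ hr, h2⟩

theorem rows_ok : ∀ r ∈ rows, (r.2.1, r.2.2.1) ∈ tab1 ++ tab2 ∧
    (r.2.2.2.1, r.2.2.2.2.1) ∈ tab1 ++ tab2 ∧
    r.2.2.1 + r.2.1 ≤ r.2.2.2.2.1 + 1 ∧
    1000 * r.2.2.2.1 ≤ 1000 * r.1 + 16 * r.1 * r.2.2.2.2.2 ∧ 0 < r.1 ∧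
    27182818286 ^ r.2.2.2.2.2 ≤ r.1 ^ 100 * 10 ^ (10 * r.2.2.2.2.2) := by
  decide +kernel

theorem log_lower (a l : ℕ) (ha : 0 < a) (h : 27182818286 ^ l ≤ a ^ 100 * 10 ^ (10 * l)) :
    (l : ℝ) / 100 ≤ Real.log a := by
  have h1 : Real.exp 1 ≤ 2.7182818286 := Real.exp_one_lt_d9.le
  have h2 : Real.exp 1 ^ l ≤ (a : ℝ) ^ 100 := by
    calc Real.exp 1 ^ l ≤ (2.7182818286 : ℝ) ^ l := by gcongr
      _ = (27182818286 : ℝ) ^ l / 10 ^ (10 * l) := by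
        rw [pow_mul, ← div_pow]; norm_num
      _ ≤ (a : ℝ) ^ 100 := by
        rw [div_le_iff₀ (by positivity)]
        exact_mod_cast h
  have h3 := Real.log_le_log (by positivity) h2
  rw [Real.log_pow, Real.log_pow, Real.log_exp] at h3
  push_cast at h3
  linarith

theorem nth_gt (k : ℕ) : k + 1 ≤ Nat.nth Nat.Prime (Nat.primeCounting k) := by
  rw [Nat.primeCounting, Nat.primeCounting']
  exact Nat.le_nth_count Nat.infinite_setOfPred_prime _

theorem small (k : ℕ) (hk : 213 ≤ k) (hk' : k < 16001) :
    (Nat.nth Nat.Prime (Nat.primeCounting k + k - 1) : ℝ) -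
        (Nat.nth Nat.Prime (Nat.primeCounting k) : ℝ) ≤ 1.6 * k * Real.log k := by
  obtain ⟨⟨a, b, cb, X, cX, l⟩, hr, h1, h2⟩ :=
    covers_ok k hk' rows 213 hk (by decide +kernel)
  obtain ⟨r1, r2, r3, r4, r5, r6⟩ := rows_ok _ hr
  simp only at h1 h2 r1 r2 r3 r4 r5 r6
  have c1 := tab_ok _ r1
  have c2 := tab_ok _ r2
  simp only at c1 c2
  have hl := log_lower a l r5 r6
  have hp : Nat.primeCounting k ≤ cb := by
    rw [← c1, Nat.primeCounting, Nat.primeCounting']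
    exact Nat.count_monotone _ (by omega)
  have hlt : Nat.nth Nat.Prime (Nat.primeCounting k + k - 1) < X := by
    apply Nat.nth_lt_of_lt_count
    rw [c2]; omega
  have hq := nth_gt k
  have hlt' : (Nat.nth Nat.Prime (Nat.primeCounting k + k - 1) : ℝ) ≤ X := by exact_mod_cast hlt.le
  have hq' : (k : ℝ) + 1 ≤ (Nat.nth Nat.Prime (Nat.primeCounting k) : ℝ) := by exact_mod_cast hq
  have r4' : (1000 : ℝ) * X ≤ 1000 * a + 16 * a * l := by exact_mod_cast r4
  have ha : (0 : ℝ) < a := by exact_mod_cast r5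
  have hak : (a : ℝ) ≤ k := by exact_mod_cast h1
  have hlog : Real.log a ≤ Real.log k := Real.log_le_log ha hak
  have hl0 : (0 : ℝ) ≤ l := by positivity
  have : (a : ℝ) * (l / 100) ≤ k * Real.log k := by
    apply mul_le_mul hak (hl.trans hlog) (by positivity) (by positivity)
  linarith

theorem adm (k : ℕ) (p : ℕ) (hp : p.Prime) : ∃ r : ZMod p,
      ∀ j < k, (Nat.nth Nat.Prime (Nat.primeCounting k + j) : ZMod p) ≠ r := by
  by_cases hpk : p ≤ k
  · refine ⟨0, fun j _ h => ?_⟩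
    rw [ZMod.natCast_eq_zero_iff] at h
    have h1 := (Nat.prime_dvd_prime_iff_eq hp (Nat.prime_nth_prime _)).1 h
    have h2 := nth_gt k
    have h3 : Nat.nth Nat.Prime (Nat.primeCounting k) ≤
        Nat.nth Nat.Prime (Nat.primeCounting k + j) :=
      Nat.nth_monotone Nat.infinite_setOfPred_prime (by omega)
    omega
  · have : NeZero p := ⟨hp.ne_zero⟩
    by_contra hcon
    push Not at hcon
    have h1 : (Finset.univ : Finset (ZMod p)) ⊆ (Finset.range k).image
        (fun j => (Nat.nth Nat.Prime (Nat.primeCounting k + j) : ZMod p)) := by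
      intro r _
      obtain ⟨j, hj, h⟩ := hcon r
      exact Finset.mem_image.2 ⟨j, Finset.mem_range.2 hj, h⟩
    have h2 := (Finset.card_le_card h1).trans Finset.card_image_le
    rw [Finset.card_univ, ZMod.card, Finset.card_range] at h2
    omega

theorem dvd_key (M : ℕ) :
    (30 * M)! * M ! ∣ (15 * M)! * (10 * M)! * (6 * M)! * lcmUpto (30 * M) := by
  have f1 := Nat.factorial_ne_zero
  have f2 := Nat.lcmUpto_ne_zero
  rw [← Nat.factorization_prime_le_iff_dvd (by simp [f1]) (by simp [f1, f2])]
  intro p hp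
  rw [Nat.factorization_mul (f1 _) (f1 _), Nat.factorization_mul (by simp [f1]) (f2 _),
    Nat.factorization_mul (by simp [f1]) (f1 _), Nat.factorization_mul (f1 _) (f1 _)]
  simp only [Finsupp.add_apply]
  rw [Nat.factorization_lcmUpto _ hp]
  have mono : ∀ n, n ≤ 30 * M → Nat.log p n < Nat.log p (30 * M) + 1 := fun n hn =>
    Nat.lt_succ_of_le (Nat.log_mono_right hn)
  rw [Nat.factorization_factorial hp (mono (30 * M) le_rfl),
    Nat.factorization_factorial hp (mono M (by omega)),
    Nat.factorization_factorial hp (mono (15 * M) (by omega)),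
    Nat.factorization_factorial hp (mono (10 * M) (by omega)),
    Nat.factorization_factorial hp (mono (6 * M) (by omega))]
  have hc : Nat.log p (30 * M) = ∑ i ∈ Finset.Ico 1 (Nat.log p (30 * M) + 1), 1 := by simp
  refine le_trans ?_ (Nat.add_le_add_left hc.ge _)
  rw [← Finset.sum_add_distrib, ← Finset.sum_add_distrib, ← Finset.sum_add_distrib,
    ← Finset.sum_add_distrib]
  apply Finset.sum_le_sum
  intro i _
  generalize p ^ i = q
  have e1 : M / q = (30 * M) / q / 30 := by
    rw [Nat.div_div_eq_div_mul, Nat.mul_comm q 30, Nat.mul_div_mul_left _ _ (by norm_num)]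
  have e2 : (15 * M) / q = (30 * M) / q / 2 := by
    rw [Nat.div_div_eq_div_mul, Nat.mul_comm q 2, show 30 * M = 2 * (15 * M) by ring,
      Nat.mul_div_mul_left _ _ (by norm_num)]
  have e3 : (10 * M) / q = (30 * M) / q / 3 := by
    rw [Nat.div_div_eq_div_mul, Nat.mul_comm q 3, show 30 * M = 3 * (10 * M) by ring,
      Nat.mul_div_mul_left _ _ (by norm_num)]
  have e4 : (6 * M) / q = (30 * M) / q / 5 := by
    rw [Nat.div_div_eq_div_mul, Nat.mul_comm q 5, show 30 * M = 5 * (6 * M) by ring,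
      Nat.mul_div_mul_left _ _ (by norm_num)]
  rw [e1, e2, e3, e4]
  omega

theorem stirling_up (n : ℕ) (hn : n ≠ 0) :
    Real.log (n ! : ℝ) ≤ n * Real.log n - n + Real.log n / 2 + 1 := by
  obtain ⟨m, rfl⟩ := Nat.exists_eq_succ_of_ne_zero hn
  have h1 := Stirling.log_stirlingSeq'_antitone (Nat.zero_le m)
  simp only [Function.comp] at h1
  rw [Stirling.log_stirlingSeq_formula, Nat.succ_eq_add_one 0, zero_add,
    Stirling.stirlingSeq_one] at h1
  have hx : (0 : ℝ) < (m.succ : ℝ) := by positivity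
  generalize (m.succ : ℝ) = x at *
  rw [Real.log_div (Real.exp_pos 1).ne' (by positivity), Real.log_exp, Real.log_sqrt (by norm_num),
    Real.log_mul (by norm_num) hx.ne', Real.log_div hx.ne' (Real.exp_pos 1).ne', Real.log_exp] at h1
  linarith

theorem stirling_lo (n : ℕ) (hn : n ≠ 0) :
    n * Real.log n - n + Real.log n / 2 ≤ Real.log (n ! : ℝ) := by
  have h := Stirling.le_log_factorial_stirling hn
  have : 0 ≤ Real.log (2 * Real.pi) := Real.log_nonneg (by linarith [Real.pi_gt_three])
  linarith

theorem cheb (M : ℕ) (hM : M ≠ 0) :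
    27.63 * M - 3 ≤ ((Nat.primeCounting (30 * M) : ℝ) + 1 / 2) * Real.log (30 * M) := by
  have f0 : ∀ n : ℕ, ((n ! : ℕ) : ℝ) ≠ 0 := fun n => by exact_mod_cast Nat.factorial_ne_zero n
  have hl0 : ((lcmUpto (30 * M) : ℕ) : ℝ) ≠ 0 := by exact_mod_cast Nat.lcmUpto_ne_zero _
  have h1 := Nat.le_of_dvd (Nat.pos_of_ne_zero (by
    simp [Nat.factorial_ne_zero, Nat.lcmUpto_ne_zero])) (dvd_key M)
  have h2 : (((30 * M)! : ℕ) : ℝ) * (M ! : ℕ) ≤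
    ((15 * M)! : ℕ) * ((10 * M)! : ℕ) * ((6 * M)! : ℕ) * (lcmUpto (30 * M) : ℕ) := by
    exact_mod_cast h1
  have h3 := Real.log_le_log (by
    have := f0 (30 * M); have := f0 M; positivity) h2
  rw [Real.log_mul (f0 _) (f0 _), Real.log_mul (by simp [f0]) hl0,
    Real.log_mul (by simp [f0]) (f0 _), Real.log_mul (f0 _) (f0 _),
    ← Chebyshev.psi_eq_log_lcmUpto] at h3
  have h4 := Chebyshev.psi_le_primeCounting_mul_log (30 * M)
  have s1 := stirling_lo (30 * M) (by omega)
  have s2 := stirling_lo M hM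
  have s3 := stirling_up (15 * M) (by omega)
  have s4 := stirling_up (10 * M) (by omega)
  have s5 := stirling_up (6 * M) (by omega)
  have hM0 : (M : ℝ) ≠ 0 := by exact_mod_cast hM
  have hMp : (0 : ℝ) < M := by positivity
  have hc := log_lower (2 ^ 14 * 3 ^ 9 * 5 ^ 5) 2763 (by norm_num) (by decide +kernel)
  have hce : (((2 ^ 14 * 3 ^ 9 * 5 ^ 5 : ℕ)) : ℝ) = (2 : ℝ) ^ 14 * 3 ^ 9 * 5 ^ 5 := by norm_num
  rw [hce] at hc
  rw [Real.log_mul (by norm_num) (by norm_num), Real.log_mul (by norm_num) (by norm_num),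
    Real.log_pow, Real.log_pow, Real.log_pow] at hc
  clear hce
  push_cast at *
  have l30 : Real.log 30 = Real.log 2 + Real.log 3 + Real.log 5 := by
    rw [← Real.log_mul (by norm_num) (by norm_num), ← Real.log_mul (by norm_num) (by norm_num)]
    norm_num
  have l15 : Real.log 15 = Real.log 3 + Real.log 5 := by
    rw [← Real.log_mul (by norm_num) (by norm_num)]; norm_num
  have l10 : Real.log 10 = Real.log 2 + Real.log 5 := by
    rw [← Real.log_mul (by norm_num) (by norm_num)]; norm_num
  have l6 : Real.log 6 = Real.log 2 + Real.log 3 := by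
    rw [← Real.log_mul (by norm_num) (by norm_num)]; norm_num
  rw [Real.log_mul (by norm_num) hM0] at s1 s3 s4 s5 h4 ⊢
  rw [l30] at s1 h4 ⊢
  rw [l15] at s3
  rw [l10] at s4
  rw [l6] at s5
  have hc' := mul_le_mul_of_nonneg_left hc hMp.le
  nlinarith

theorem pi_up (k : ℕ) (hk : 16000 ≤ k) :
    (Nat.primeCounting k : ℝ) ≤ 48 / 210 * k - 1747 := by
  obtain ⟨n, rfl⟩ := Nat.exists_eq_add_of_le hk
  have h := Nat.primeCounting_add_le (a := 210) (k := 16000) (by norm_num) (by norm_num) n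
  have h0 : Nat.primeCounting 16000 = 1862 :=
    tab_ok (16001, 1862) (by decide +kernel)
  have ht : Nat.totient 210 = 48 := by decide +kernel
  rw [h0, ht] at h
  have h' : (Nat.primeCounting (16000 + n) : ℝ) ≤ 1862 + 48 * ((n / 210 : ℕ) + 1) := by
    exact_mod_cast h
  have hd : ((n / 210 : ℕ) : ℝ) ≤ n / 210 := by exact_mod_cast Nat.cast_div_le
  push_cast
  linarith

theorem large (k : ℕ) (hk : 16000 ≤ k) :
    (Nat.nth Nat.Prime (Nat.primeCounting k + k - 1) : ℝ) -
        (Nat.nth Nat.Prime (Nat.primeCounting k) : ℝ) ≤ 1.6 * k * Real.log k := by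
  have hkR : (16000 : ℝ) ≤ k := by exact_mod_cast hk
  have hk0 : (0 : ℝ) < k := by linarith
  have hL0 := log_lower 16000 968 (by norm_num) (by decide +kernel)
  have hL : (9.68 : ℝ) ≤ Real.log k := by
    have := Real.log_le_log (by norm_num) hkR
    push_cast at hL0
    linarith
  have hpi := pi_up k hk
  set L := Real.log k with hLdef
  set y : ℝ := 1.6 * L + 1 with hy
  have hy0 : 0 < y := by linarith
  have hX0 : 0 ≤ (k * y) / 30 := by positivity
  set M := ⌊(k * y) / 30⌋₊ with hMdef
  have hM1 : (M : ℝ) ≤ (k * y) / 30 := Nat.floor_le hX0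
  have hM2 : (k * y) / 30 < M + 1 := Nat.lt_floor_add_one _
  have hky : 16000 * 16 ≤ k * y := by
    apply mul_le_mul hkR (by linarith) (by norm_num) hk0.le
  have hMpos : (0 : ℝ) < M := by linarith
  have hM : M ≠ 0 := by rintro h; rw [h] at hMpos; simp at hMpos
  have hch := cheb M hM
  have hlog1 : Real.log (30 * M) ≤ L + Real.log y := by
    rw [hLdef, ← Real.log_mul hk0.ne' hy0.ne']
    apply Real.log_le_log (by positivity); linarith
  have hlogy : Real.log y ≤ y / 16 + 1.7726 := by
    have h1 := Real.log_le_sub_one_of_pos (show 0 < y / 16 by positivity)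
    rw [Real.log_div hy0.ne' (by norm_num), show (16 : ℝ) = 2 ^ 4 by norm_num, Real.log_pow] at h1
    have := Real.log_two_lt_d9
    norm_num at h1 ⊢
    linarith
  have main : Nat.primeCounting k + k ≤ Nat.primeCounting (30 * M) := by
    by_contra hcon
    have hcon' : (Nat.primeCounting (30 * M) : ℝ) + 1 ≤ Nat.primeCounting k + k := by
      exact_mod_cast (not_le.1 hcon)
    have hlogpos : 0 ≤ Real.log (30 * M) := Real.log_nonneg (by linarith)
    have b1 : 27.63 * M - 3 ≤ (Nat.primeCounting k + k) * (L + (y / 16 + 1.7726)) := by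
      refine hch.trans ?_
      apply mul_le_mul (by linarith) (by linarith) hlogpos (by positivity)
    have b2 : 0.921 * (k * y) - 31 ≤ (Nat.primeCounting k + k) * (L + (y / 16 + 1.7726)) := by
      linarith
    have hz : 0 ≤ L + (y / 16 + 1.7726) := by positivity
    rcases le_total k 75000 with hcase | hcase
    · have hcR : (k : ℝ) ≤ 75000 := by exact_mod_cast hcase
      have b3 : (Nat.primeCounting k : ℝ) + k ≤ 1.2053 * k := by linarith
      have b4 := b2.trans (mul_le_mul_of_nonneg_right b3 hz)
      have b5 : 0.921 * y - 0.002 ≤ 1.2053 * (L + (y / 16 + 1.7726)) := by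
        by_contra hneg
        have := mul_lt_mul_of_pos_left (not_le.1 hneg) hk0
        linarith
      rw [hy] at b5
      linarith
    · have hcR : (75000 : ℝ) ≤ k := by exact_mod_cast hcase
      have hL0' := log_lower 75000 1122 (by norm_num) (by decide +kernel)
      have hL' : (11.22 : ℝ) ≤ L := by
        have := Real.log_le_log (by norm_num) hcR
        push_cast at hL0'
        linarith
      have b3 : (Nat.primeCounting k : ℝ) + k ≤ 1.22858 * k := by linarith
      have b4 := b2.trans (mul_le_mul_of_nonneg_right b3 hz)
      have b5 : 0.921 * y - 0.002 ≤ 1.22858 * (L + (y / 16 + 1.7726)) := by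
        by_contra hneg
        have := mul_lt_mul_of_pos_left (not_le.1 hneg) hk0
        linarith
      rw [hy] at b5
      linarith
  have hlt : Nat.nth Nat.Prime (Nat.primeCounting k + k - 1) < 30 * M + 1 := by
    apply Nat.nth_lt_of_lt_count
    have : Nat.primeCounting (30 * M) = Nat.count Nat.Prime (30 * M + 1) := rfl
    omega
  have hq' : (k : ℝ) + 1 ≤ (Nat.nth Nat.Prime (Nat.primeCounting k) : ℝ) := by
    exact_mod_cast nth_gt k
  have hlt' : (Nat.nth Nat.Prime (Nat.primeCounting k + k - 1) : ℝ) ≤ 30 * M := by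
    exact_mod_cast Nat.lt_succ_iff.1 hlt
  have : (k : ℝ) * y = 1.6 * k * L + k := by rw [hy]; ring
  linarith

end PT

theorem prime_tuple_admissible_and_diameter (k : ℕ) (hk : 213 ≤ k) :
    -- the set ℋ = {q_{π(k)+1}, …, q_{π(k)+k}} (with q_n the n-th prime, 1-indexed,
    -- i.e. q_n = Nat.nth Nat.Prime (n-1)) is admissible:
    (∀ p : ℕ, p.Prime → ∃ r : ZMod p,
      ∀ j < k, (Nat.nth Nat.Prime (Nat.primeCounting k + j) : ZMod p) ≠ r) ∧
    -- and its diameter is at most 1.6·k·log k: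
    (Nat.nth Nat.Prime (Nat.primeCounting k + k - 1) : ℝ) -
        (Nat.nth Nat.Prime (Nat.primeCounting k) : ℝ) ≤ 1.6 * k * Real.log k := by
  refine ⟨fun p hp => PT.adm k p hp, ?_⟩
  rcases lt_or_ge k 16001 with h | h
  · exact PT.small k hk h
  · exact PT.large k (by omega)
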